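/- arXiv:2202.06896 — 4 statements merged into one kernel-verified Lean document; each statement's English description precedes it below -/
import Mathlib

section
/- Let n ≥ 1, H : ℝⁿ × ℝⁿ → ℝ smooth, and β : ℝⁿ × ℝⁿ → ℝⁿ smooth (the components βᵢ(q,p) of a semibasic external-force one-form β = βᵢ dqⁱ). Define the forced Hamiltonian vector field X_{H,β}(q,p) = (∂H/∂pᵢ, −∂H/∂qⁱ − βᵢ)(q,p), determined by ι_{X_{H,β}}Ω_Q − dH = β with Ω_Q = dqⁱ ∧ dpᵢ. Let σ : ℝⁿ → ℝⁿ be a closed one-form (∂σᵢ/∂qʲ = ∂σⱼ/∂qⁱ for all i, j), and let X_{H,β}^σ(q) have components (∂H/∂pᵢ)(q, σ(q)). Then the following are equivalent: (i) X_{H,β}^σ and X_{H,β} are σ-related, i.e. Σᵢ (∂σⱼ/∂qⁱ)(q)·(∂H/∂pᵢ)(q,σ(q)) = −(∂H/∂qʲ)(q,σ(q)) − βⱼ(q,σ(q)) for all j, q; (ii) d(H ∘ σ) = −σ*β, i.e. ∂/∂qʲ [H(q, σ(q))] = −βⱼ(q, σ(q)) for all j, q. -/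
/-- The chain rule for `q ↦ H (q, σ q)`, with the fibre derivative of `H` expanded in coordinates. -/
theorem fderiv_comp_graph_apply {ι E : Type*} [Fintype ι] [DecidableEq ι]
    [NormedAddCommGroup E] [NormedSpace ℝ E] {H : E × (ι → ℝ) → ℝ} {σ : E → ι → ℝ} {q : E}
    (hH : DifferentiableAt ℝ H (q, σ q)) (hσ : DifferentiableAt ℝ σ q) (v : E) :
    fderiv ℝ (fun q' => H (q', σ q')) q v =
      fderiv ℝ H (q, σ q) (v, 0) +
        ∑ i, fderiv ℝ (fun q' => σ q' i) q v * fderiv ℝ H (q, σ q) (0, Pi.single i 1) := by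
  have hchain : HasFDerivAt (fun q' => H (q', σ q'))
      ((fderiv ℝ H (q, σ q)).comp ((ContinuousLinearMap.id ℝ E).prod (fderiv ℝ σ q))) q :=
    HasFDerivAt.comp (f := fun q' => (q', σ q')) q hH.hasFDerivAt
      ((hasFDerivAt_id q).prodMk hσ.hasFDerivAt)
  have hcoord (i : ι) : fderiv ℝ (fun q' => σ q' i) q v = fderiv ℝ σ q v i := by
    rw [(hasFDerivAt_pi'.1 hσ.hasFDerivAt i).fderiv]
    rfl
  have hfibre (w : ι → ℝ) : fderiv ℝ H (q, σ q) (0, w) =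
      ∑ i, w i * fderiv ℝ H (q, σ q) (0, Pi.single i 1) := by
    change ((fderiv ℝ H (q, σ q)).comp (ContinuousLinearMap.inr ℝ E (ι → ℝ))) w = _
    conv_lhs => rw [pi_eq_sum_univ' w]
    rw [map_sum]
    simp only [map_smul, smul_eq_mul]
    rfl
  have hsplit : (v, fderiv ℝ σ q v) = (v, 0) + (0, fderiv ℝ σ q v) := by simp
  simp only [hcoord]
  rw [hchain.fderiv, ← hfibre, ← map_add, ← hsplit]
  rfl

/-- **Hamilton–Jacobi theorem for systems with external forces.**
For a Hamiltonian `H` and a semibasic external force one-form `β = βᵢ dqⁱ`, with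
forced dynamics `X_{H,β} = (∂H/∂pᵢ, −∂H/∂qⁱ − βᵢ)`, and a closed one-form `σ`,
`X_{H,β}^σ` and `X_{H,β}` are `σ`-related iff `d(H ∘ σ) = −σ*β`. -/
theorem stmt_4 (n : ℕ) (hn : 1 ≤ n)
    (H : (Fin n → ℝ) × (Fin n → ℝ) → ℝ) (hH : ContDiff ℝ (⊤ : ℕ∞) H)
    (β : (Fin n → ℝ) × (Fin n → ℝ) → (Fin n → ℝ)) (hβ : ContDiff ℝ (⊤ : ℕ∞) β)
    (σ : (Fin n → ℝ) → (Fin n → ℝ)) (hσ : ContDiff ℝ (⊤ : ℕ∞) σ)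
    (hclosed : ∀ (i j : Fin n) (q : Fin n → ℝ),
      fderiv ℝ (fun q' => σ q' i) q (Pi.single j 1) =
        fderiv ℝ (fun q' => σ q' j) q (Pi.single i 1)) :
    (∀ (j : Fin n) (q : Fin n → ℝ),
        ∑ i, fderiv ℝ (fun q' => σ q' j) q (Pi.single i 1) *
            fderiv ℝ H (q, σ q) ((0 : Fin n → ℝ), Pi.single i 1) =
          - fderiv ℝ H (q, σ q) (Pi.single j 1, (0 : Fin n → ℝ)) - β (q, σ q) j) ↔
    (∀ (j : Fin n) (q : Fin n → ℝ),
        fderiv ℝ (fun q' => H (q', σ q')) q (Pi.single j 1) = - β (q, σ q) j) := by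
  refine forall₂_congr fun j q => ?_
  rw [fderiv_comp_graph_apply (hH.differentiable (by simp) _) (hσ.differentiable (by simp) _)]
  simp only [hclosed _ j q]
  constructor <;> intro h <;> linarith
end

section
/- Let n, m ≥ 1, with smooth algebroid data ρⁱ_α : ℝⁿ → ℝ and C^γ_{αβ} : ℝⁿ → ℝ (skew in (α,β)), smooth Hamiltonian H : ℝⁿ × ℝᵐ → ℝ, and the almost-Poisson Hamiltonian vector field q̇ⁱ = Σ_β ρⁱ_β(∂H/∂p_β), ṗ_α = −(Σᵢ ρⁱ_α(∂H/∂qⁱ) + Σ_{β,γ} C^γ_{αβ}p_γ(∂H/∂p_β)). Assume the algebroid is completely nonholonomic: the vector fields ρ_α(q) = (ρ¹_α(q),…,ρⁿ_α(q)), α = 1,…,m, together with all their iterated Lie brackets span ℝⁿ at every point. Let ψ : ℝⁿ → ℝᵐ be smooth with d^Dψ = 0, i.e. Σ_γ C^γ_{δβ}ψ_γ = Σᵢ [ρⁱ_δ(∂ψ_β/∂qⁱ) − ρⁱ_β(∂ψ_δ/∂qⁱ)] for all δ, β. Then the projected field X^ψ(q) (with components Σ_β ρⁱ_β(q)(∂H/∂p_β)(q,ψ(q)))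 and the Hamiltonian vector field are ψ-related if and only if the function q ↦ H(q, ψ(q)) is constant on ℝⁿ. -/
noncomputable section

/-- The Lie bracket of vector fields on `ℝⁿ`. -/
def vbracket (n : ℕ) (X Y : (Fin n → ℝ) → (Fin n → ℝ)) :
    (Fin n → ℝ) → (Fin n → ℝ) :=
  fun q => fderiv ℝ Y q (X q) - fderiv ℝ X q (Y q)

/-- Iterated bracket families of a finite family of vector fields. -/
def brkFam (n m : ℕ) (X : Fin m → (Fin n → ℝ) → (Fin n → ℝ)) :
    ℕ → Set ((Fin n → ℝ) → (Fin n → ℝ))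
  | 0 => Set.range X
  | k + 1 => brkFam n m X k ∪
      {Z | ∃ A ∈ brkFam n m X k, ∃ B ∈ brkFam n m X k, Z = vbracket n A B}

/-- Members of the iterated bracket families of smooth vector fields are smooth, and they
annihilate every smooth function annihilated by the generating fields. -/
theorem brkFam_contDiff_and_fderiv_eq_zero {n m : ℕ} {X : Fin m → (Fin n → ℝ) → (Fin n → ℝ)}
    (hX : ∀ a, ContDiff ℝ (⊤ : ℕ∞) (X a)) {F : (Fin n → ℝ) → ℝ}
    (hF : ContDiff ℝ (⊤ : ℕ∞) F) (hFX : ∀ a q, fderiv ℝ F q (X a q) = 0) (k : ℕ) :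
    ∀ Z ∈ brkFam n m X k, ContDiff ℝ (⊤ : ℕ∞) Z ∧ ∀ q, fderiv ℝ F q (Z q) = 0 := by
  induction k with
  | zero =>
    rintro _ ⟨a, rfl⟩
    exact ⟨hX a, hFX a⟩
  | succ k ih =>
    rintro Z (hZ | ⟨A, hA, B, hB, rfl⟩)
    · exact ih Z hZ
    obtain ⟨hA, hFA⟩ := ih A hA
    obtain ⟨hB, hFB⟩ := ih B hB
    have hbr : vbracket n A B = VectorField.lieBracket ℝ A B := rfl
    rw [hbr]
    refine ⟨hA.lieBracket_vectorField hB (by simp), fun q ↦ ?_⟩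
    have h2 : minSmoothness ℝ 2 ≤ ((⊤ : ℕ∞) : WithTop ℕ∞) := by
      rw [minSmoothness_of_isRCLikeNormedField]
      exact WithTop.coe_le_coe.2 (le_top : (2 : ℕ∞) ≤ ⊤)
    rw [VectorField.fderiv_apply_lieBracket hF.contDiffAt h2
      (hB.differentiable (by simp) q) (hA.differentiable (by simp) q)]
    simp [hFA, hFB]

/-- A smooth function annihilated by a bracket-generating family of smooth vector fields has
vanishing derivative. -/
theorem fderiv_eq_zero_of_bracket_generating {n m : ℕ}
    {X : Fin m → (Fin n → ℝ) → (Fin n → ℝ)}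
    (hX : ∀ a, ContDiff ℝ (⊤ : ℕ∞) (X a)) {F : (Fin n → ℝ) → ℝ}
    (hF : ContDiff ℝ (⊤ : ℕ∞) F) (hFX : ∀ a q, fderiv ℝ F q (X a q) = 0) (q : Fin n → ℝ)
    (hbg : Submodule.span ℝ {v : Fin n → ℝ | ∃ k, ∃ Z ∈ brkFam n m X k, v = Z q} = ⊤) :
    fderiv ℝ F q = 0 := by
  refine ContinuousLinearMap.coe_injective (LinearMap.ext_on hbg ?_)
  rintro _ ⟨k, Z, hZ, rfl⟩
  exact (brkFam_contDiff_and_fderiv_eq_zero hX hF hFX k Z hZ).2 q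

/-- A linear functional on `ℝⁿ` evaluated in coordinates. -/
theorem apply_eq_sum_mul_single {n : ℕ} (L : (Fin n → ℝ) →L[ℝ] ℝ) (v : Fin n → ℝ) :
    L v = ∑ i, v i * L (Pi.single i 1) := by
  conv_lhs => rw [pi_eq_sum_univ' v]
  simp [map_sum]

/-- A linear functional on `ℝⁿ × ℝᵐ` evaluated in coordinates. -/
theorem apply_prod_eq_sum_mul_single {n m : ℕ} (L : (Fin n → ℝ) × (Fin m → ℝ) →L[ℝ] ℝ)
    (v : Fin n → ℝ) (w : Fin m → ℝ) :
    L (v, w) = ∑ i, v i * L (Pi.single i 1, 0) + ∑ j, w j * L (0, Pi.single j 1) := by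
  have h₁ := apply_eq_sum_mul_single (L.comp (.inl ℝ _ _)) v
  have h₂ := apply_eq_sum_mul_single (L.comp (.inr ℝ _ _)) w
  simp only [ContinuousLinearMap.comp_apply, ContinuousLinearMap.inl_apply,
    ContinuousLinearMap.inr_apply] at h₁ h₂
  rw [← h₁, ← h₂, ← map_add]
  simp

/-- **Hamilton–Jacobi theorem for completely nonholonomic linear almost Poisson
structures.** If the anchor vector fields `ρ_α` are bracket-generating, then for a
section `ψ` with `d^Dψ = 0` the projected field and the almost-Poisson Hamiltonian
vector field are `ψ`-related iff `q ↦ H(q, ψ(q))` is constant. -/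
theorem stmt_15 (n m : ℕ) (hn : 1 ≤ n) (hm : 1 ≤ m)
    (ρ : Fin n → Fin m → (Fin n → ℝ) → ℝ)
    (hρ : ∀ i a, ContDiff ℝ (⊤ : ℕ∞) (ρ i a))
    (C : Fin m → Fin m → Fin m → (Fin n → ℝ) → ℝ)
    (hC : ∀ g a b, ContDiff ℝ (⊤ : ℕ∞) (C g a b))
    (hCskew : ∀ g a b q, C g a b q = - C g b a q)
    (hbg : ∀ q : Fin n → ℝ,
      Submodule.span ℝ {v : Fin n → ℝ | ∃ k,
        ∃ Z ∈ brkFam n m (fun a q' i => ρ i a q') k, v = Z q} = ⊤)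
    (H : (Fin n → ℝ) × (Fin m → ℝ) → ℝ) (hH : ContDiff ℝ (⊤ : ℕ∞) H)
    (ψ : (Fin n → ℝ) → (Fin m → ℝ)) (hψ : ContDiff ℝ (⊤ : ℕ∞) ψ)
    (hdψ : ∀ (δ β : Fin m) (q : Fin n → ℝ),
      ∑ g, C g δ β q * ψ q g =
        ∑ i, (ρ i δ q * fderiv ℝ (fun q' => ψ q' β) q (Pi.single i 1) -
              ρ i β q * fderiv ℝ (fun q' => ψ q' δ) q (Pi.single i 1))) :
    (∀ q : Fin n → ℝ,
        fderiv ℝ ψ q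
          (fun i => ∑ β, ρ i β q *
            fderiv ℝ H (q, ψ q) ((0 : Fin n → ℝ), Pi.single β 1)) =
        fun α => - ((∑ i, ρ i α q * fderiv ℝ H (q, ψ q) (Pi.single i 1, (0 : Fin m → ℝ))) +
          ∑ β, ∑ g, C g α β q * ψ q g *
            fderiv ℝ H (q, ψ q) ((0 : Fin n → ℝ), Pi.single β 1))) ↔
    (∀ q q' : Fin n → ℝ, H (q, ψ q) = H (q', ψ q')) := by
  set F : (Fin n → ℝ) → ℝ := fun q ↦ H (q, ψ q) with hF_def
  set X : Fin m → (Fin n → ℝ) → (Fin n → ℝ) := fun a q i ↦ ρ i a q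
  have hF : ContDiff ℝ (⊤ : ℕ∞) F := hH.comp (contDiff_id.prodMk hψ)
  have hX : ∀ a, ContDiff ℝ (⊤ : ℕ∞) (X a) := fun a ↦ contDiff_pi.2 fun i ↦ hρ i a
  have hψd : Differentiable ℝ ψ := hψ.differentiable (by simp)
  have hψ_coord (q v : Fin n → ℝ) (b : Fin m) :
      fderiv ℝ (fun q' ↦ ψ q' b) q v = fderiv ℝ ψ q v b := by
    rw [fderiv_apply (hψd q)]
    rfl
  have hdF (q v : Fin n → ℝ) : fderiv ℝ F q v = fderiv ℝ H (q, ψ q) (v, fderiv ℝ ψ q v) := by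
    have h := (hH.differentiable (by simp) (q, ψ q)).hasFDerivAt.comp q
      ((hasFDerivAt_id q).prodMk (hψd q).hasFDerivAt)
    have h' : HasFDerivAt F _ q := h
    rw [h'.fderiv]
    rfl
  have hdψ' (a b : Fin m) (q : Fin n → ℝ) :
      ∑ g, C g a b q * ψ q g = fderiv ℝ ψ q (X a q) b - fderiv ℝ ψ q (X b q) a := by
    rw [hdψ, Finset.sum_sub_distrib, ← hψ_coord, ← hψ_coord, apply_eq_sum_mul_single _ (X a q),
      apply_eq_sum_mul_single _ (X b q)]
  have hXψ (q : Fin n → ℝ) :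
      (fun i ↦ ∑ β, ρ i β q * fderiv ℝ H (q, ψ q) ((0 : Fin n → ℝ), Pi.single β 1)) =
        ∑ β, fderiv ℝ H (q, ψ q) ((0 : Fin n → ℝ), Pi.single β 1) • X β q := by
    ext i
    simp [X, Finset.sum_apply, mul_comm]
  have hrel (q : Fin n → ℝ) (a : Fin m) :
      - ((∑ i, ρ i a q * fderiv ℝ H (q, ψ q) (Pi.single i 1, (0 : Fin m → ℝ))) +
          ∑ β, ∑ g, C g a β q * ψ q g *
            fderiv ℝ H (q, ψ q) ((0 : Fin n → ℝ), Pi.single β 1)) =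
        fderiv ℝ ψ q (fun i ↦ ∑ β, ρ i β q *
            fderiv ℝ H (q, ψ q) ((0 : Fin n → ℝ), Pi.single β 1)) a -
          fderiv ℝ F q (X a q) := by
    simp only [← Finset.sum_mul, hdψ', sub_mul, Finset.sum_sub_distrib]
    rw [hdF, apply_prod_eq_sum_mul_single, hXψ]
    simp only [map_sum, map_smul, Finset.sum_apply, Pi.smul_apply, smul_eq_mul]
    simp only [mul_comm (fderiv ℝ H (q, ψ q) ((0 : Fin n → ℝ), _))]
    ring
  have hann : (∀ q : Fin n → ℝ,
        fderiv ℝ ψ q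
          (fun i => ∑ β, ρ i β q *
            fderiv ℝ H (q, ψ q) ((0 : Fin n → ℝ), Pi.single β 1)) =
        fun α => - ((∑ i, ρ i α q * fderiv ℝ H (q, ψ q) (Pi.single i 1, (0 : Fin m → ℝ))) +
          ∑ β, ∑ g, C g α β q * ψ q g *
            fderiv ℝ H (q, ψ q) ((0 : Fin n → ℝ), Pi.single β 1))) ↔
      ∀ a q, fderiv ℝ F q (X a q) = 0 := by
    simp only [funext_iff, hrel, eq_comm (b := _ - _), sub_eq_self]
    exact forall_comm
  rw [hann]
  constructor
  · intro h
    exact is_const_of_fderiv_eq_zero (hF.differentiable (by simp))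
      fun q ↦ fderiv_eq_zero_of_bracket_generating hX hF h q (hbg q)
  · intro h a q
    have hconst : F = fun _ ↦ F q := funext fun q' ↦ h q' q
    rw [hconst]
    simp
end
end

section
/- Let n ≥ 1 and H : ℝⁿ × ℝⁿ × ℝ → ℝ smooth (coordinates (q, p, z)), with evolution vector field ε_H having components q̇ⁱ = ∂H/∂pᵢ, ṗᵢ = −∂H/∂qⁱ − pᵢ(∂H/∂z), ż = Σᵢpᵢ(∂H/∂pᵢ). Let γ : ℝⁿ × ℝ → ℝⁿ be a smooth section (q,z) ↦ γ(q,z) satisfying the coordinate form of the coisotropic/Legendrian hypotheses: ∂γᵢ/∂qʲ = ∂γⱼ/∂qⁱ for all i, j (at each fixed z), and ∂γᵢ/∂z = σ·γᵢ for some smooth function σ(q,z) and all i. Let ε_H^γ(q,z) = ((∂H/∂pᵢ), Σᵢγᵢ(∂H/∂pᵢ)), evaluated at (q, γ(q,z), z). Then ε_H and ε_H^γ are γ-related (the derivative of (q,z) ↦ (q, γ(q,z), z) sends ε_H^γ(q,z) to ε_H(q, γ(q,z), z)) if and only if for all j, q, z: ∂/∂qʲ[H(q, γ(q,z), z)] +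 γ₀(q,z)·γⱼ(q,z) = 0, where γ₀ = (∂H/∂z) + Σᵢ(∂H/∂pᵢ)(∂γᵢ/∂z), with the derivatives of H evaluated at (q, γ(q,z), z) (the Hamilton–Jacobi equation d(H∘γ) + γ₀·γ*Θ_Q = 0 for the evolution vector field). -/
noncomputable section

/-- The evolution vector field of `H(q,p,z)` on `T*ℝⁿ × ℝ` with contact form
`η = dz − pᵢdqⁱ`: components `(∂H/∂pᵢ, −∂H/∂qⁱ − pᵢ∂H/∂z, Σᵢpᵢ∂H/∂pᵢ)`. -/
def evolVF (n : ℕ) (H : (Fin n → ℝ) × (Fin n → ℝ) × ℝ → ℝ) :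
    (Fin n → ℝ) × (Fin n → ℝ) × ℝ → (Fin n → ℝ) × (Fin n → ℝ) × ℝ :=
  fun w =>
    ((fun i => fderiv ℝ H w ((0 : Fin n → ℝ), Pi.single i 1, (0 : ℝ))),
     (fun i => - fderiv ℝ H w (Pi.single i 1, (0 : Fin n → ℝ), (0 : ℝ))
        - w.2.1 i * fderiv ℝ H w ((0 : Fin n → ℝ), (0 : Fin n → ℝ), (1 : ℝ))),
     ∑ i, w.2.1 i * fderiv ℝ H w ((0 : Fin n → ℝ), Pi.single i 1, (0 : ℝ)))

/-- A linear map on `ℝⁿ` is determined by its values on the standard basis. -/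
lemma map_eq_sum_smul_single {n : ℕ} {F : Type*} [AddCommGroup F] [Module ℝ F]
    (L : (Fin n → ℝ) →ₗ[ℝ] F) (v : Fin n → ℝ) :
    L v = ∑ i, v i • L (Pi.single i 1) := by
  conv_lhs => rw [pi_eq_sum_univ' v]
  simp only [map_sum, map_smul]

lemma fderiv_section_graph {n : ℕ} {γ : (Fin n → ℝ) × ℝ → (Fin n → ℝ)}
    (x : (Fin n → ℝ) × ℝ) (hγ : DifferentiableAt ℝ γ x) (u : (Fin n → ℝ) × ℝ) :
    fderiv ℝ (fun y : (Fin n → ℝ) × ℝ =>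
      ((y.1, γ y, y.2) : (Fin n → ℝ) × (Fin n → ℝ) × ℝ)) x u =
      (u.1, fderiv ℝ γ x u, u.2) := by
  rw [(hasFDerivAt_fst.prodMk (hγ.hasFDerivAt.prodMk hasFDerivAt_snd)).fderiv]
  rfl

lemma fderiv_section_apply {n : ℕ} {γ : (Fin n → ℝ) × ℝ → (Fin n → ℝ)}
    (x : (Fin n → ℝ) × ℝ) (hγ : DifferentiableAt ℝ γ x) (i : Fin n) (u : (Fin n → ℝ) × ℝ) :
    fderiv ℝ (fun y => γ y i) x u = fderiv ℝ γ x u i := by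
  rw [((hasFDerivAt_pi'.1 hγ.hasFDerivAt) i).fderiv]
  rfl

lemma fderiv_section_slice {n : ℕ} {γ : (Fin n → ℝ) × ℝ → (Fin n → ℝ)}
    (x : (Fin n → ℝ) × ℝ) (hγ : DifferentiableAt ℝ γ x) (i : Fin n) (u : Fin n → ℝ) :
    fderiv ℝ (fun q => γ (q, x.2) i) x.1 u = fderiv ℝ γ x (u, 0) i := by
  have h : HasFDerivAt (fun q => γ (q, x.2)) _ x.1 :=
    HasFDerivAt.comp x.1 (g := γ) hγ.hasFDerivAt (hasFDerivAt_prodMk_left x.1 x.2)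
  rw [((hasFDerivAt_pi'.1 h) i).fderiv]
  rfl

lemma fderiv_comp_section_slice {n : ℕ} {H : (Fin n → ℝ) × (Fin n → ℝ) × ℝ → ℝ}
    {γ : (Fin n → ℝ) × ℝ → (Fin n → ℝ)} (x : (Fin n → ℝ) × ℝ)
    (hH : DifferentiableAt ℝ H (x.1, γ x, x.2)) (hγ : DifferentiableAt ℝ γ x)
    (u : Fin n → ℝ) :
    fderiv ℝ (fun q => H (q, γ (q, x.2), x.2)) x.1 u =
      fderiv ℝ H (x.1, γ x, x.2) (u, 0, 0) +
        ∑ i, fderiv ℝ γ x (u, 0) i *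
          fderiv ℝ H (x.1, γ x, x.2) (0, Pi.single i 1, 0) := by
  have h : HasFDerivAt (fun q => γ (q, x.2)) _ x.1 :=
    HasFDerivAt.comp x.1 (g := γ) hγ.hasFDerivAt (hasFDerivAt_prodMk_left x.1 x.2)
  have h' := HasFDerivAt.comp x.1 (g := H)
    (f := fun q => ((q, γ (q, x.2), x.2) : (Fin n → ℝ) × (Fin n → ℝ) × ℝ)) hH.hasFDerivAt
    ((hasFDerivAt_id x.1).prodMk (h.prodMk (hasFDerivAt_const x.2 x.1)))
  have e : fderiv ℝ (fun q => H (q, γ (q, x.2), x.2)) x.1 u =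
      fderiv ℝ H (x.1, γ x, x.2) (u, fderiv ℝ γ x (u, 0), 0) := by
    have h'' := h'.fderiv
    simp only [Function.comp_def] at h''
    rw [h'']
    rfl
  have hsum := map_eq_sum_smul_single ((fderiv ℝ H (x.1, γ x, x.2)).toLinearMap ∘ₗ
    LinearMap.inr ℝ (Fin n → ℝ) ((Fin n → ℝ) × ℝ) ∘ₗ LinearMap.inl ℝ (Fin n → ℝ) ℝ)
    (fderiv ℝ γ x (u, 0))
  simp only [LinearMap.comp_apply, LinearMap.inl_apply, LinearMap.inr_apply,
    ContinuousLinearMap.coe_coe, smul_eq_mul] at hsum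
  rw [e, ← hsum, ← map_add]
  simp

lemma fderiv_section_eq_sum {n : ℕ} (γ : (Fin n → ℝ) × ℝ → (Fin n → ℝ))
    (x : (Fin n → ℝ) × ℝ) (v : Fin n → ℝ) (s : ℝ) (j : Fin n) :
    fderiv ℝ γ x (v, s) j =
      ∑ i, v i * fderiv ℝ γ x (Pi.single i 1, 0) j + s * fderiv ℝ γ x (0, 1) j := by
  have hsum := congrFun (map_eq_sum_smul_single
    ((fderiv ℝ γ x).toLinearMap ∘ₗ LinearMap.inl ℝ (Fin n → ℝ) ℝ) v) j
  simp only [LinearMap.comp_apply, LinearMap.inl_apply,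
    ContinuousLinearMap.coe_coe, Finset.sum_apply, Pi.smul_apply, smul_eq_mul] at hsum
  have e : ((v, s) : (Fin n → ℝ) × ℝ) = (v, 0) + s • (0, 1) := by simp
  rw [e, map_add, map_smul, ← hsum]
  rfl

/-- **Hamilton–Jacobi theorem for the evolution vector field, Approach I.**
For a section `γ(q,z)` satisfying the coisotropic/Legendrian hypotheses
(`d_Qγ = 0` and `∂γ/∂z = σγ`), `ε_H` and `ε_H^γ` are `γ`-related iff
`d(H∘γ) + γ₀·γ*Θ_Q = 0` with `γ₀ = ∂H/∂z + Σᵢ(∂H/∂pᵢ)(∂γᵢ/∂z)`. -/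
theorem stmt_18 (n : ℕ) (hn : 1 ≤ n)
    (H : (Fin n → ℝ) × (Fin n → ℝ) × ℝ → ℝ) (hH : ContDiff ℝ (⊤ : ℕ∞) H)
    (γ : (Fin n → ℝ) × ℝ → (Fin n → ℝ)) (hγ : ContDiff ℝ (⊤ : ℕ∞) γ)
    (hclosed : ∀ (i j : Fin n) (q : Fin n → ℝ) (z : ℝ),
      fderiv ℝ (fun q' => γ (q', z) i) q (Pi.single j 1) =
        fderiv ℝ (fun q' => γ (q', z) j) q (Pi.single i 1))
    (σ : (Fin n → ℝ) × ℝ → ℝ) (hσ : ContDiff ℝ (⊤ : ℕ∞) σ)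
    (hz : ∀ (i : Fin n) (x : (Fin n → ℝ) × ℝ),
      fderiv ℝ (fun y => γ y i) x ((0 : Fin n → ℝ), (1 : ℝ)) = σ x * γ x i) :
    (∀ x : (Fin n → ℝ) × ℝ,
        fderiv ℝ (fun y : (Fin n → ℝ) × ℝ =>
            ((y.1, γ y, y.2) : (Fin n → ℝ) × (Fin n → ℝ) × ℝ)) x
          ((fun i => fderiv ℝ H (x.1, γ x, x.2)
              ((0 : Fin n → ℝ), Pi.single i 1, (0 : ℝ))),
           ∑ i, γ x i * fderiv ℝ H (x.1, γ x, x.2)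
              ((0 : Fin n → ℝ), Pi.single i 1, (0 : ℝ))) =
        evolVF n H (x.1, γ x, x.2)) ↔
    (∀ (j : Fin n) (x : (Fin n → ℝ) × ℝ),
        fderiv ℝ (fun q' => H (q', γ (q', x.2), x.2)) x.1 (Pi.single j 1) +
        (fderiv ℝ H (x.1, γ x, x.2) ((0 : Fin n → ℝ), (0 : Fin n → ℝ), (1 : ℝ)) +
          ∑ i, fderiv ℝ H (x.1, γ x, x.2) ((0 : Fin n → ℝ), Pi.single i 1, (0 : ℝ)) *
            fderiv ℝ (fun y => γ y i) x ((0 : Fin n → ℝ), (1 : ℝ))) * γ x j = 0) := by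
  have dγ : Differentiable ℝ γ := hγ.differentiable (by simp)
  have dH : Differentiable ℝ H := hH.differentiable (by simp)
  rw [forall_comm]
  refine forall_congr' fun x => ?_
  have hcl (i j : Fin n) : fderiv ℝ γ x (Pi.single i 1, 0) j =
      fderiv ℝ γ x (Pi.single j 1, 0) i := by
    rw [← fderiv_section_slice x (dγ x), ← fderiv_section_slice x (dγ x)]
    exact hclosed j i x.1 x.2
  have hzj (j : Fin n) : fderiv ℝ γ x (0, 1) j = σ x * γ x j := by
    rw [← fderiv_section_apply x (dγ x), hz]
  rw [fderiv_section_graph x (dγ x)]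
  simp only [evolVF, Prod.mk.injEq, true_and, and_true, hz, funext_iff]
  refine forall_congr' fun j => ?_
  rw [fderiv_section_eq_sum, hzj, fderiv_comp_section_slice x (dH _) (dγ x)]
  simp only [hcl _ j]
  have h₁ : ∑ i, fderiv ℝ H (x.1, γ x, x.2) (0, Pi.single i 1, 0) * (σ x * γ x i) =
      σ x * ∑ i, γ x i * fderiv ℝ H (x.1, γ x, x.2) (0, Pi.single i 1, 0) := by
    rw [Finset.mul_sum]
    exact Finset.sum_congr rfl fun i _ => by ring
  have h₂ : ∑ i, fderiv ℝ H (x.1, γ x, x.2) (0, Pi.single i 1, 0) *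
      fderiv ℝ γ x (Pi.single j 1, 0) i =
      ∑ i, fderiv ℝ γ x (Pi.single j 1, 0) i *
        fderiv ℝ H (x.1, γ x, x.2) (0, Pi.single i 1, 0) :=
    Finset.sum_congr rfl fun i _ => mul_comm _ _
  rw [h₁, h₂]
  constructor <;> intro h <;> linear_combination h
end
end

section
/- Let n ≥ 1 and H : ℝⁿ × ℝⁿ × ℝ → ℝ smooth (coordinates (q, p, z)), with evolution vector field ε_H having components q̇ⁱ = ∂H/∂pᵢ, ṗᵢ = −∂H/∂qⁱ − pᵢ(∂H/∂z), ż = Σᵢpᵢ(∂H/∂pᵢ). Let f : ℝⁿ → ℝ be smooth and let γ(q) = (q, ∇f(q), f(q)) be its first jet prolongation (so the image of γ is a Legendrian submanifold of (T*ℝⁿ × ℝ, dz − pᵢdqⁱ)). Let ε_H^γ(q) ∈ ℝⁿ have components (∂H/∂pᵢ)(q, ∇f(q), f(q)). Then ε_H and ε_H^γ are γ-related (i.e. Dγ(q)(ε_H^γ(q)) = ε_H(γ(q)) for all q) if and only if d(H∘γ) = 0, i.e. the function q ↦ H(q, ∇f(q), f(q)) has identically vanishing derivative on ℝⁿ (hence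 is constant). -/
noncomputable section

theorem ContinuousLinearMap.apply_eq_sum_single {n : ℕ} (g : (Fin n → ℝ) →L[ℝ] ℝ)
    (v : Fin n → ℝ) : g v = ∑ j, v j * g (Pi.single j 1) := by
  conv_lhs => rw [pi_eq_sum_univ' v]
  simp

theorem ContinuousLinearMap.apply_jet_eq {n : ℕ} (L : (Fin n → ℝ) × (Fin n → ℝ) × ℝ →L[ℝ] ℝ)
    (u v : Fin n → ℝ) (c : ℝ) :
    L (u, v, c) = L (u, 0, 0) + ∑ j, v j * L (0, Pi.single j 1, 0) + c * L (0, 0, 1) := by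
  have hsplit : (u, v, c) = (u, (0 : Fin n → ℝ), (0 : ℝ)) + (0, v, 0) + c • (0, 0, 1) := by
    simp
  have hv := (L.comp ((inr ℝ (Fin n → ℝ) ((Fin n → ℝ) × ℝ)).comp
    (inl ℝ (Fin n → ℝ) ℝ))).apply_eq_sum_single v
  simp only [comp_apply, inl_apply, inr_apply] at hv
  rw [hsplit, map_add, map_add, map_smul, hv, smul_eq_mul]

/-- The derivative of the first jet prolongation of `f`. -/
theorem hasFDerivAt_jetProlongation {n : ℕ} {f : (Fin n → ℝ) → ℝ} (hf : ContDiff ℝ 2 f)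
    (q : Fin n → ℝ) :
    HasFDerivAt (fun q' : Fin n → ℝ =>
        ((q', fun i => fderiv ℝ f q' (Pi.single i 1), f q') : (Fin n → ℝ) × (Fin n → ℝ) × ℝ))
      ((ContinuousLinearMap.id ℝ (Fin n → ℝ)).prod
        ((ContinuousLinearMap.pi fun i =>
          (fderiv ℝ (fderiv ℝ f) q).flip (Pi.single i 1)).prod (fderiv ℝ f q))) q := by
  have hf' : DifferentiableAt ℝ (fderiv ℝ f) q :=
    (hf.fderiv_right (m := 1) (by norm_num)).differentiable (by norm_num) q
  refine (hasFDerivAt_id q).prodMk (HasFDerivAt.prodMk (hasFDerivAt_pi.2 fun i => ?_)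
    (hf.differentiable (by norm_num) q).hasFDerivAt)
  convert hf'.hasFDerivAt.clm_apply (hasFDerivAt_const (Pi.single i (1 : ℝ)) q) using 1
  ext v
  simp

/-- **Hamilton–Jacobi theorem for the evolution vector field, Approach II.**
For the first jet prolongation `γ(q) = (q, ∇f(q), f(q))` of a smooth `f`
(a Legendrian section), `ε_H` and `ε_H^γ` are `γ`-related iff
`q ↦ H(q, ∇f(q), f(q))` has identically vanishing derivative. -/
theorem stmt_19 (n : ℕ) (hn : 1 ≤ n)
    (H : (Fin n → ℝ) × (Fin n → ℝ) × ℝ → ℝ) (hH : ContDiff ℝ (⊤ : ℕ∞) H)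
    (f : (Fin n → ℝ) → ℝ) (hf : ContDiff ℝ (⊤ : ℕ∞) f) :
    (∀ q : Fin n → ℝ,
        fderiv ℝ (fun q' : Fin n → ℝ =>
            ((q', fun i => fderiv ℝ f q' (Pi.single i 1), f q') :
              (Fin n → ℝ) × (Fin n → ℝ) × ℝ)) q
          (fun i => fderiv ℝ H
              (q, (fun i' => fderiv ℝ f q (Pi.single i' 1)), f q)
              ((0 : Fin n → ℝ), Pi.single i 1, (0 : ℝ))) =
        evolVF n H (q, (fun i' => fderiv ℝ f q (Pi.single i' 1)), f q)) ↔
    (∀ q : Fin n → ℝ,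
        fderiv ℝ (fun q' : Fin n → ℝ =>
          H (q', (fun i' => fderiv ℝ f q' (Pi.single i' 1)), f q')) q = 0) := by
  refine forall_congr' fun q => ?_
  have hf2 : ContDiff ℝ 2 f := contDiff_infty.1 hf 2
  have hγ := hasFDerivAt_jetProlongation hf2 q
  have hHγ := (hH.differentiable (by simp)
    (q, (fun i => fderiv ℝ f q (Pi.single i 1)), f q)).hasFDerivAt.comp q hγ
  have hsymm : IsSymmSndFDerivAt ℝ f q := hf2.contDiffAt.isSymmSndFDerivAt (by simp)
  have hcomp := hHγ.fderiv
  simp only [Function.comp_def] at hcomp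
  rw [hγ.fderiv, hcomp]
  unfold evolVF
  set L := fderiv ℝ H (q, (fun i => fderiv ℝ f q (Pi.single i 1)), f q)
  set B := fderiv ℝ (fderiv ℝ f) q
  set X : Fin n → ℝ := fun i => L (0, Pi.single i 1, 0)
  have hX (i : Fin n) : B X (Pi.single i 1) = ∑ j, B (Pi.single i 1) (Pi.single j 1) * X j := by
    rw [hsymm.eq X (Pi.single i 1), (B (Pi.single i 1)).apply_eq_sum_single X]
    exact Finset.sum_congr rfl fun j _ => mul_comm _ _
  have hz : fderiv ℝ f q X = ∑ i, fderiv ℝ f q (Pi.single i 1) * X i := by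
    rw [(fderiv ℝ f q).apply_eq_sum_single X]
    exact Finset.sum_congr rfl fun j _ => mul_comm _ _
  have hd (i : Fin n) : L (Pi.single i 1, (fun j => B (Pi.single i 1) (Pi.single j 1)),
      fderiv ℝ f q (Pi.single i 1)) = L (Pi.single i 1, 0, 0) + B X (Pi.single i 1)
        + fderiv ℝ f q (Pi.single i 1) * L (0, 0, 1) := by
    rw [L.apply_jet_eq, hX]
  constructor
  · intro h
    refine ContinuousLinearMap.coe_injective (LinearMap.pi_ext' fun i => LinearMap.ext_ring ?_)
    have hi : B X (Pi.single i 1) = - L (Pi.single i 1, 0, 0)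
        - fderiv ℝ f q (Pi.single i 1) * L (0, 0, 1) :=
      congrFun (congrArg Prod.fst (congrArg Prod.snd h)) i
    refine (hd i).trans (?_ : _ = (0 : ℝ))
    linarith
  · intro h
    refine Prod.ext rfl (Prod.ext (funext fun i => ?_) hz)
    have hi := (hd i).symm.trans (DFunLike.congr_fun h (Pi.single i 1))
    change B X (Pi.single i 1) = - L (Pi.single i 1, 0, 0)
        - fderiv ℝ f q (Pi.single i 1) * L (0, 0, 1)
    rw [zero_apply] at hi
    linarith
end
end
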